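/- arXiv:2112.04088 — 4 statements merged into one kernel-verified Lean document; each statement's English description precedes it below -/
import Mathlib

section
/- Let d ≥ 1, let x ∈ ℝ^d (a function x : Fin d → ℝ), let 1 ≤ k ≤ d, and let S ⊆ Fin d be a set of coordinates with |S| = k such that |x_j| ≤ |x_i| for every i ∈ S and j ∉ S (i.e., S consists of k coordinates of largest absolute value). Then ∑_{i ∈ S} x_i² ≥ (k/d) · ∑_{i=1}^{d} x_i². Equivalently, the top-k sparsification T_k(x) of x satisfies ‖T_k(x)‖² ≥ (k/d)‖x‖². -/
/-- If every value of `f` on `t` is at most every value of `f` on `s`, then the average of `f`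
over `t` is at most its average over `s`, stated without division. -/
theorem Finset.card_mul_sum_le_card_mul_sum {ι : Type*} {s t : Finset ι} {f : ι → ℝ}
    (h : ∀ i ∈ s, ∀ j ∈ t, f j ≤ f i) :
    (s.card : ℝ) * ∑ j ∈ t, f j ≤ t.card * ∑ i ∈ s, f i := by
  calc (s.card : ℝ) * ∑ j ∈ t, f j = ∑ _i ∈ s, ∑ j ∈ t, f j := by
        rw [Finset.sum_const, nsmul_eq_mul]
    _ ≤ ∑ i ∈ s, ∑ _j ∈ t, f i :=
        Finset.sum_le_sum fun i hi => Finset.sum_le_sum fun j hj => h i hi j hj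
    _ = t.card * ∑ i ∈ s, f i := by
        simp only [Finset.sum_const, nsmul_eq_mul, Finset.mul_sum]

/-- Top-k sparsification keeps at least a k/d fraction of the squared norm:
if `S` consists of `k` coordinates of largest absolute value of `x : ℝ^d`,
then `∑_{i ∈ S} x i ^ 2 ≥ (k / d) * ∑ i, x i ^ 2`. -/
theorem topk_sq_norm_ge (d k : ℕ) (hd : 1 ≤ d) (x : Fin d → ℝ)
    (hk1 : 1 ≤ k) (hkd : k ≤ d) (S : Finset (Fin d)) (hS : S.card = k)
    (htop : ∀ i ∈ S, ∀ j ∉ S, |x j| ≤ |x i|) :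
    (∑ i ∈ S, x i ^ 2) ≥ ((k : ℝ) / d) * ∑ i, x i ^ 2 := by
  have hd0 : (0 : ℝ) < d := by exact_mod_cast hd
  have hcompl : (Sᶜ.card : ℝ) = d - k := by
    rw [Finset.card_compl, Fintype.card_fin, hS, Nat.cast_sub hkd]
  have hle := Finset.card_mul_sum_le_card_mul_sum (s := S) (t := Sᶜ) (f := fun i => x i ^ 2)
    fun i hi j hj => sq_le_sq.mpr (htop i hi j (Finset.mem_compl.mp hj))
  rw [hS, hcompl] at hle
  rw [ge_iff_le, ← Finset.sum_add_sum_compl S, div_mul_eq_mul_div, div_le_iff₀ hd0]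
  linarith
end

section
/- (Lemma 2, deterministic form: boundedness of the error-feedback residuals.) Let E be a real normed vector space, let δ ∈ (0,1), γ ≥ 0, B ≥ 0, and let e, u : ℕ → E be sequences with e_0 = 0, ‖u_t‖ ≤ B for all t, and ‖e_{t+1}‖² ≤ (1 − δ)‖γ·u_t + e_t‖² for all t (the δ-approximate-compressor property of the update e_{t+1} = g_t − T_k(g_t) with g_t = γ·u_t + e_t). Then for every t ≥ 0, ‖e_t‖² ≤ (4(1 − δ)/δ²) · γ² B². -/
/-- Lemma 2 (deterministic form): boundedness of the error-feedback residuals.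
If `e 0 = 0`, `‖u t‖ ≤ B`, and `‖e (t+1)‖² ≤ (1 - δ)‖γ • u t + e t‖²` for all `t`,
with `δ ∈ (0,1)`, then `‖e t‖² ≤ (4(1-δ)/δ²) γ² B²` for every `t`. -/
theorem error_feedback_residual_bound {E : Type*} [NormedAddCommGroup E] [NormedSpace ℝ E]
    (δ γ B : ℝ) (hδ0 : 0 < δ) (hδ1 : δ < 1) (hγ : 0 ≤ γ) (hB : 0 ≤ B)
    (e u : ℕ → E) (he0 : e 0 = 0) (hu : ∀ t, ‖u t‖ ≤ B)
    (hrec : ∀ t, ‖e (t + 1)‖ ^ 2 ≤ (1 - δ) * ‖γ • u t + e t‖ ^ 2) :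
    ∀ t, ‖e t‖ ^ 2 ≤ (4 * (1 - δ) / δ ^ 2) * γ ^ 2 * B ^ 2 := by
  obtain ⟨s, hs0, hs⟩ : ∃ s : ℝ, 0 ≤ s ∧ s ^ 2 = 1 - δ :=
    ⟨√(1 - δ), Real.sqrt_nonneg _, Real.sq_sqrt (by linarith)⟩
  have hsδ : s ≤ 1 - δ / 2 := by nlinarith [sq_nonneg (s - 1)]
  have hM : 0 ≤ γ * B := mul_nonneg hγ hB
  have hbound : ∀ t, ‖e t‖ ≤ s * (2 * (γ * B) / δ) := by
    intro t
    induction t with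
    | zero => rw [he0, norm_zero]; positivity
    | succ t ih =>
      have hstep : ‖e (t + 1)‖ ≤ s * ‖γ • u t + e t‖ := by
        refine (sq_le_sq₀ (norm_nonneg _) (by positivity)).mp ?_
        rw [mul_pow, hs]
        exact hrec t
      have hg : ‖γ • u t + e t‖ ≤ γ * B + s * (2 * (γ * B) / δ) := by
        refine (norm_add_le _ _).trans (add_le_add ?_ ih)
        rw [norm_smul, Real.norm_of_nonneg hγ]
        exact mul_le_mul_of_nonneg_left (hu t) hγ
      refine hstep.trans (mul_le_mul_of_nonneg_left (hg.trans ?_) hs0)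
      have hR : 0 ≤ 2 * (γ * B) / δ := by positivity
      calc γ * B + s * (2 * (γ * B) / δ)
          ≤ γ * B + (1 - δ / 2) * (2 * (γ * B) / δ) := by gcongr
        _ = 2 * (γ * B) / δ := by field_simp; ring
  intro t
  calc ‖e t‖ ^ 2 ≤ (s * (2 * (γ * B) / δ)) ^ 2 := by gcongr; exact hbound t
    _ = (4 * (1 - δ) / δ ^ 2) * γ ^ 2 * B ^ 2 := by rw [← hs]; ring
end

section
/- (Auxiliary-sequence identity, Equation (8).) Let V be a real vector space, let M ≥ 1 be a natural number, γ ∈ ℝ, and S ⊆ Fin M. Let p, q, eOld, eNew, Tn, To : Fin M → V and ω, ω', ν, ν' ∈ V satisfy: (i) ν = ω − (1/M)·∑_{m} eOld_m and ν' = ω' − (1/M)·∑_{m} eNew_m; (ii) ω' = ω − (1/M)·(∑_{m∈S} Tn_m + ∑_{m∉S} To_m); (iii) for every m ∈ S, Tn_m + eNew_m = γ·p_m + eOld_m; (iv) for every m ∉ S, To_m + eNew_m = γ·q_m + eOld_m. Then ν' − ν = −(γ/M)·∑_{m=1}^{M} p_m + (γ/M)·∑_{m∉S} (p_m − q_m).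 -/
/-- Auxiliary-sequence identity (Equation (8) of the SASG paper):
with `ν = ω - (1/M)∑ eOld`, `ν' = ω' - (1/M)∑ eNew`,
`ω' = ω - (1/M)(∑_{m∈S} Tn_m + ∑_{m∉S} To_m)`,
`Tn_m + eNew_m = γ p_m + eOld_m` for `m ∈ S`, and
`To_m + eNew_m = γ q_m + eOld_m` for `m ∉ S`, one has
`ν' - ν = -(γ/M) ∑_m p_m + (γ/M) ∑_{m∉S} (p_m - q_m)`. -/
theorem aux_sequence_identity {V : Type*} [AddCommGroup V] [Module ℝ V]
    (M : ℕ) (hM : 1 ≤ M) (γ : ℝ) (S : Finset (Fin M))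
    (p q eOld eNew Tn To : Fin M → V) (ω ω' ν ν' : V)
    (hν : ν = ω - (1 / (M : ℝ)) • ∑ m, eOld m)
    (hν' : ν' = ω' - (1 / (M : ℝ)) • ∑ m, eNew m)
    (hω' : ω' = ω - (1 / (M : ℝ)) • (∑ m ∈ S, Tn m + ∑ m ∈ Sᶜ, To m))
    (hS : ∀ m ∈ S, Tn m + eNew m = γ • p m + eOld m)
    (hSc : ∀ m ∉ S, To m + eNew m = γ • q m + eOld m) :
    ν' - ν = -((γ / (M : ℝ)) • ∑ m, p m) + (γ / (M : ℝ)) • ∑ m ∈ Sᶜ, (p m - q m) := by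
  have hfresh : ∑ m ∈ S, Tn m = γ • ∑ m ∈ S, p m + ∑ m ∈ S, eOld m - ∑ m ∈ S, eNew m := by
    rw [eq_sub_iff_add_eq, ← Finset.sum_add_distrib, Finset.smul_sum, ← Finset.sum_add_distrib]
    exact Finset.sum_congr rfl hS
  have hstale : ∑ m ∈ Sᶜ, To m =
      γ • ∑ m ∈ Sᶜ, q m + ∑ m ∈ Sᶜ, eOld m - ∑ m ∈ Sᶜ, eNew m := by
    rw [eq_sub_iff_add_eq, ← Finset.sum_add_distrib, Finset.smul_sum, ← Finset.sum_add_distrib]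
    exact Finset.sum_congr rfl fun m hm => hSc m (Finset.mem_compl.mp hm)
  rw [hν', hν, hω', hfresh, hstale, Finset.sum_sub_distrib, ← Finset.sum_add_sum_compl S eOld,
    ← Finset.sum_add_sum_compl S eNew, ← Finset.sum_add_sum_compl S p]
  module
end

section
/- (Lemma 4, arithmetic form: descent of the Lyapunov function.) Let D ≥ 1, M ≥ 1 be natural numbers, and let L > 0, γ > 0, δ ∈ (0,1), σ² ≥ 0, B² ≥ 0 be reals, with nonnegative constants α_1,…,α_D and β_1,…,β_D (set β_{D+1} := 0). Let F, F' ∈ ℝ, G ≥ 0, and D_1,…,D_D ≥ 0, D'_1,…,D'_D ≥ 0 be reals satisfying: (i) D'_{d+1} = D_d for d = 1,…,D−1; (ii) F' − F ≤ −(γ − ((5L+4)/2)γ²)·G + ∑_{d=1}^{D} (α_d/(2M²L) + L/2 + 2γ²(L+1)α_d/M²)·D_d + 2L²(1−δ)γ²B²/(δ²M) + (10(L+1) + 2DL)·γ²σ²/M; (iii) D'_1 ≤ 8γ²·G + (8γ²/M²)·∑_{d=1}^{D} α_d D_d + 40γ²σ²/M + 16(1−δ)γ²B²/(δ²M). Define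 c_f := γ − ((5L+4)/2 + 8β_1)γ², c_d := β_d − β_{d+1} − (α_d/(2M²L) + L/2 + 2γ²α_d(L+1+4β_1)/M²) for d = 1,…,D, a := 10(L+1) + 2DL + 40β_1, and b := (2L² + 16β_1)(1−δ)/δ². Then (F' + ∑_{d=1}^{D} β_d D'_d) − (F + ∑_{d=1}^{D} β_d D_d) ≤ −c_f·G − ∑_{d=1}^{D} c_d·D_d + a·γ²σ²/M + b·γ²B²/M. -/
/-- A weighted sum of a shifted sequence whose weights vanish past the top index. -/
theorem sum_Icc_weighted_shift (n : ℕ) (β x y : ℕ → ℝ) (htop : β (n + 2) = 0)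
    (hshift : ∀ d, 1 ≤ d → d ≤ n → y (d + 1) = x d) :
    ∑ d ∈ Finset.Icc 1 (n + 1), β d * y d
      = β 1 * y 1 + ∑ d ∈ Finset.Icc 1 (n + 1), β (d + 1) * x d := by
  have split_first : ∑ d ∈ Finset.Icc 1 (n + 1), β d * y d
      = β 1 * y 1 + ∑ d ∈ Finset.Icc 1 n, β (d + 1) * y (d + 1) := by
    clear htop hshift
    induction n with
    | zero => simp
    | succ k ih =>
      rw [Finset.sum_Icc_succ_top (by omega), ih, Finset.sum_Icc_succ_top (by omega), add_assoc]
  rw [split_first, Finset.sum_Icc_succ_top (by omega), htop, zero_mul, add_zero]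
  congr 1
  refine Finset.sum_congr rfl fun d hd => ?_
  rw [Finset.mem_Icc] at hd
  rw [hshift d hd.1 hd.2]

/-- Lemma 4 of the SASG paper, arithmetic form: descent of the Lyapunov function
`𝓛 = F + ∑_{d=1}^D β_d D_d`.  Here `F, F'` abstract `E[F(ν^t)] - F*` and `E[F(ν^{t+1})] - F*`,
`G` abstracts `E‖∇F(ω^t)‖²`, `Dd d` abstracts `‖ω^{t+1-d} - ω^{t-d}‖²` and
`Dd' d` abstracts `‖ω^{t+2-d} - ω^{t+1-d}‖²`. -/
theorem lyapunov_descent (D M : ℕ) (hD : 1 ≤ D) (hM : 1 ≤ M)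
    (L γ δ σ2 B2 : ℝ) (hL : 0 < L) (hγ : 0 < γ) (hδ0 : 0 < δ) (hδ1 : δ < 1)
    (hσ2 : 0 ≤ σ2) (hB2 : 0 ≤ B2)
    (α β : ℕ → ℝ) (hα : ∀ d ∈ Finset.Icc 1 D, 0 ≤ α d) (hβ : ∀ d ∈ Finset.Icc 1 D, 0 ≤ β d)
    (hβtop : β (D + 1) = 0)
    (F F' G : ℝ) (hG : 0 ≤ G)
    (Dd Dd' : ℕ → ℝ) (hDd : ∀ d ∈ Finset.Icc 1 D, 0 ≤ Dd d)
    (hDd' : ∀ d ∈ Finset.Icc 1 D, 0 ≤ Dd' d)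
    (hshift : ∀ d, 1 ≤ d → d ≤ D - 1 → Dd' (d + 1) = Dd d)
    (hdescent : F' - F ≤ -(γ - (5 * L + 4) / 2 * γ ^ 2) * G
        + ∑ d ∈ Finset.Icc 1 D,
            (α d / (2 * (M : ℝ) ^ 2 * L) + L / 2 + 2 * γ ^ 2 * (L + 1) * α d / (M : ℝ) ^ 2) * Dd d
        + 2 * L ^ 2 * (1 - δ) * γ ^ 2 * B2 / (δ ^ 2 * M)
        + (10 * (L + 1) + 2 * D * L) * γ ^ 2 * σ2 / M)
    (hstep : Dd' 1 ≤ 8 * γ ^ 2 * G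
        + (8 * γ ^ 2 / (M : ℝ) ^ 2) * ∑ d ∈ Finset.Icc 1 D, α d * Dd d
        + 40 * γ ^ 2 * σ2 / M
        + 16 * (1 - δ) * γ ^ 2 * B2 / (δ ^ 2 * M)) :
    (F' + ∑ d ∈ Finset.Icc 1 D, β d * Dd' d) - (F + ∑ d ∈ Finset.Icc 1 D, β d * Dd d)
      ≤ -(γ - ((5 * L + 4) / 2 + 8 * β 1) * γ ^ 2) * G
        - ∑ d ∈ Finset.Icc 1 D,
            (β d - β (d + 1)
              - (α d / (2 * (M : ℝ) ^ 2 * L) + L / 2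
                  + 2 * γ ^ 2 * α d * (L + 1 + 4 * β 1) / (M : ℝ) ^ 2)) * Dd d
        + (10 * (L + 1) + 2 * D * L + 40 * β 1) * γ ^ 2 * σ2 / M
        + (2 * L ^ 2 + 16 * β 1) * (1 - δ) / δ ^ 2 * γ ^ 2 * B2 / M := by
  have hM0 : (M : ℝ) ≠ 0 := by positivity
  obtain ⟨n, rfl⟩ : ∃ n, D = n + 1 := ⟨D - 1, by omega⟩
  have hsum := sum_Icc_weighted_shift n β Dd Dd' hβtop (by simpa using hshift)
  have hcoeff : ∑ d ∈ Finset.Icc 1 (n + 1),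
        (β d - β (d + 1)
          - (α d / (2 * (M : ℝ) ^ 2 * L) + L / 2
              + 2 * γ ^ 2 * α d * (L + 1 + 4 * β 1) / (M : ℝ) ^ 2)) * Dd d
      = ∑ d ∈ Finset.Icc 1 (n + 1), β d * Dd d
        - ∑ d ∈ Finset.Icc 1 (n + 1), β (d + 1) * Dd d
        - ∑ d ∈ Finset.Icc 1 (n + 1),
            (α d / (2 * (M : ℝ) ^ 2 * L) + L / 2 + 2 * γ ^ 2 * (L + 1) * α d / (M : ℝ) ^ 2) * Dd d
        - β 1 * ((8 * γ ^ 2 / (M : ℝ) ^ 2) * ∑ d ∈ Finset.Icc 1 (n + 1), α d * Dd d) := by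
    simp only [Finset.mul_sum, ← Finset.sum_sub_distrib]
    exact Finset.sum_congr rfl fun d _ => by ring
  have hfirst := mul_le_mul_of_nonneg_left hstep (hβ 1 (by simp))
  have hnoise : (10 * (L + 1) + 2 * ((n + 1 : ℕ) : ℝ) * L + 40 * β 1) * γ ^ 2 * σ2 / M
      = (10 * (L + 1) + 2 * ((n + 1 : ℕ) : ℝ) * L) * γ ^ 2 * σ2 / M
        + β 1 * (40 * γ ^ 2 * σ2 / M) := by
    ring
  have hcompression : (2 * L ^ 2 + 16 * β 1) * (1 - δ) / δ ^ 2 * γ ^ 2 * B2 / M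
      = 2 * L ^ 2 * (1 - δ) * γ ^ 2 * B2 / (δ ^ 2 * M)
        + β 1 * (16 * (1 - δ) * γ ^ 2 * B2 / (δ ^ 2 * M)) := by
    field_simp
  rw [hsum, hcoeff, hnoise, hcompression]
  linarith
end
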